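/- arXiv:1909.00083 — 3 statements merged into one kernel-verified Lean document; each statement's English description precedes it below -/
import Mathlib

section
/- Let (x*,u*,λ*,γ*) be a saddle point of the Lagrangian L. Then for every x ∈ X, u ∈ ℝ^{n2}, λ ∈ ℝ_{≥0}^{m1} and γ ∈ ℝ^{m2}: R(x*,u*; x,λ,γ) − R(x,u; x,λ,γ) ≤ Σ_{i=1}^{m1} (λ_i* − λ_i) g_i(x,u) + (γ* − γ)ᵀ (A x + B u − b). -/
noncomputable section

/-- Euclidean dot product on `Fin n → ℝ`. -/
def dot {n : ℕ} (x y : Fin n → ℝ) : ℝ := ∑ j, x j * y j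

/-- Squared Euclidean norm `‖x‖₂²`. -/
def sqnorm {n : ℕ} (x : Fin n → ℝ) : ℝ := ∑ j, (x j) ^ 2

/-- Euclidean norm `‖x‖₂`. -/
def enorm {n : ℕ} (x : Fin n → ℝ) : ℝ := Real.sqrt (∑ j, (x j) ^ 2)

/-- Frobenius norm `‖P‖_F`. -/
def fnorm {m n : ℕ} (P : Matrix (Fin m) (Fin n) ℝ) : ℝ :=
  Real.sqrt (∑ i, ∑ j, (P i j) ^ 2)

/-- The data of the convex QCQP (1.2). -/
structure QCQP (n1 n2 m1 m2 : ℕ) where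
  P0 : Matrix (Fin n1) (Fin n1) ℝ
  P : Fin m1 → Matrix (Fin n1) (Fin n1) ℝ
  q0 : Fin n1 → ℝ
  q : Fin m1 → Fin n1 → ℝ
  c0 : Fin n2 → ℝ
  c : Fin m1 → Fin n2 → ℝ
  r0 : ℝ
  r : Fin m1 → ℝ
  A : Matrix (Fin m2) (Fin n1) ℝ
  B : Matrix (Fin m2) (Fin n2) ℝ
  b : Fin m2 → ℝ
  Xbar : Fin n1 → ℝ

namespace QCQP

variable {n1 n2 m1 m2 : ℕ} (D : QCQP n1 n2 m1 m2)

/-- The quadratic constraint functions `g_i(x,u)`. -/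
def g (i : Fin m1) (x : Fin n1 → ℝ) (u : Fin n2 → ℝ) : ℝ :=
  (1 / 2) * dot x ((D.P i).mulVec x) + dot (D.q i) x + dot (D.c i) u + D.r i

/-- The Lagrangian `L(x,u,λ,γ)`. -/
def L (x : Fin n1 → ℝ) (u : Fin n2 → ℝ) (lam : Fin m1 → ℝ) (gam : Fin m2 → ℝ) : ℝ :=
  (1 / 2) * dot x (D.P0.mulVec x) + dot D.q0 x + dot D.c0 u + D.r0
    + ∑ i, lam i * D.g i x u
    + dot gam (D.A.mulVec x + D.B.mulVec u - D.b)

/-- The box `X = ∏_j [0, X̄_j]`. -/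
def Xset : Set (Fin n1 → ℝ) := {x | ∀ j, 0 ≤ x j ∧ x j ≤ D.Xbar j}

/-- Componentwise projection onto the box `X`. -/
def proj (x : Fin n1 → ℝ) : Fin n1 → ℝ := fun j => min (max (x j) 0) (D.Xbar j)

/-- Saddle point of the Lagrangian over `X × ℝ^{n2} × ℝ_{≥0}^{m1} × ℝ^{m2}`. -/
def SaddlePoint (xs : Fin n1 → ℝ) (us : Fin n2 → ℝ) (ls : Fin m1 → ℝ) (gs : Fin m2 → ℝ) : Prop :=
  xs ∈ D.Xset ∧ (∀ i, 0 ≤ ls i) ∧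
  (∀ lam : Fin m1 → ℝ, (∀ i, 0 ≤ lam i) → ∀ gam : Fin m2 → ℝ,
      D.L xs us lam gam ≤ D.L xs us ls gs) ∧
  (∀ x ∈ D.Xset, ∀ u : Fin n2 → ℝ, D.L xs us ls gs ≤ D.L x u ls gs)

/-- `∇_x R(·,·; x',λ',γ') = P_0 x' + q_0 + Σ_i λ'_i (P_i x' + q_i) + Aᵀ γ'`. -/
def gradx (x' : Fin n1 → ℝ) (lam' : Fin m1 → ℝ) (gam' : Fin m2 → ℝ) : Fin n1 → ℝ :=
  D.P0.mulVec x' + D.q0 + (∑ i, lam' i • ((D.P i).mulVec x' + D.q i))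
    + (D.A.transpose).mulVec gam'

/-- `∇_u R(·,·; x',λ',γ') = c_0 + Σ_i λ'_i c_i + Bᵀ γ'`. -/
def gradu (lam' : Fin m1 → ℝ) (gam' : Fin m2 → ℝ) : Fin n2 → ℝ :=
  D.c0 + (∑ i, lam' i • D.c i) + (D.B.transpose).mulVec gam'

/-- The linearized Lagrangian `R(x,u; x',λ',γ')`. -/
def R (x : Fin n1 → ℝ) (u : Fin n2 → ℝ)
    (x' : Fin n1 → ℝ) (lam' : Fin m1 → ℝ) (gam' : Fin m2 → ℝ) : ℝ :=
  dot (D.P0.mulVec x' + D.q0) x + dot D.c0 u + D.r0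
    + ∑ i, lam' i * (dot ((D.P i).mulVec x' + D.q i) x + dot (D.c i) u + D.r i)
    + dot gam' (D.A.mulVec x + D.B.mulVec u - D.b)

/-- One PC²PM iteration with step size `ρ` from `(xk,uk,lamk,gamk)`, producing the dual
predictors `mu, nu`, primal predictors `y, v`, primal correctors `x1, u1` and dual
correctors `lam1, gam1`. -/
structure Iter (ρ : ℝ) (xk : Fin n1 → ℝ) (uk : Fin n2 → ℝ)
    (lamk : Fin m1 → ℝ) (gamk : Fin m2 → ℝ)
    (mu : Fin m1 → ℝ) (nu : Fin m2 → ℝ) (y : Fin n1 → ℝ) (v : Fin n2 → ℝ)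
    (x1 : Fin n1 → ℝ) (u1 : Fin n2 → ℝ) (lam1 : Fin m1 → ℝ) (gam1 : Fin m2 → ℝ) : Prop where
  hmu : ∀ i, mu i = max 0 (lamk i + ρ * D.g i xk uk)
  hnu : nu = gamk + ρ • (D.A.mulVec xk + D.B.mulVec uk - D.b)
  hy : y = D.proj (xk - ρ • D.gradx xk lamk gamk)
  hv : v = uk - ρ • D.gradu lamk gamk
  hx1 : x1 = D.proj (xk - ρ • D.gradx y mu nu)
  hu1 : u1 = uk - ρ • D.gradu mu nu
  hlam1 : ∀ i, lam1 i = max 0 (lamk i + ρ * D.g i y v)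
  hgam1 : gam1 = gamk + ρ • (D.A.mulVec y + D.B.mulVec v - D.b)

end QCQP

/-- First-order convexity inequality for a positive semidefinite quadratic form plus a linear
form. -/
theorem dot_mulVec_add_sub_le {n : ℕ} {P : Matrix (Fin n) (Fin n) ℝ} (hP : P.PosSemidef)
    (q x y : Fin n → ℝ) :
    dot (P.mulVec x + q) y - dot (P.mulVec x + q) x ≤
      ((1 / 2) * dot y (P.mulVec y) + dot q y) - ((1 / 2) * dot x (P.mulVec x) + dot q x) := by
  have h : 0 ≤ (y - x) ⬝ᵥ P.mulVec (y - x) := by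
    simpa using hP.dotProduct_mulVec_nonneg (y - x)
  have hsymm : x ⬝ᵥ P.mulVec y = y ⬝ᵥ P.mulVec x := by
    have ht : P.transpose = P := by simpa using hP.isHermitian.eq
    rw [Matrix.dotProduct_mulVec, ← Matrix.mulVec_transpose, ht, dotProduct_comm]
  have hdot (a b : Fin n → ℝ) : dot a b = a ⬝ᵥ b := rfl
  simp only [Matrix.mulVec_sub, sub_dotProduct, dotProduct_sub] at h
  simp only [hdot, add_dotProduct, dotProduct_comm (P.mulVec x)]
  linarith

namespace QCQP

variable {n1 n2 m1 m2 : ℕ} (D : QCQP n1 n2 m1 m2)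

/-- For nonnegative `lam`, increments of the linearization of the Lagrangian at `x` are bounded by
increments of the Lagrangian. -/
theorem R_sub_R_le_L_sub_L (hP0 : D.P0.PosSemidef) (hP : ∀ i, (D.P i).PosSemidef)
    (x y : Fin n1 → ℝ) (u v : Fin n2 → ℝ) {lam : Fin m1 → ℝ} (hlam : ∀ i, 0 ≤ lam i)
    (gam : Fin m2 → ℝ) :
    D.R y v x lam gam - D.R x u x lam gam ≤ D.L y v lam gam - D.L x u lam gam := by
  have hobj := dot_mulVec_add_sub_le hP0 D.q0 x y
  have hcon : ∑ i, lam i * (dot ((D.P i).mulVec x + D.q i) y + dot (D.c i) v + D.r i)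
      - ∑ i, lam i * (dot ((D.P i).mulVec x + D.q i) x + dot (D.c i) u + D.r i)
      ≤ ∑ i, lam i * D.g i y v - ∑ i, lam i * D.g i x u := by
    simp only [← Finset.sum_sub_distrib, ← mul_sub]
    refine Finset.sum_le_sum fun i _ => mul_le_mul_of_nonneg_left ?_ (hlam i)
    have := dot_mulVec_add_sub_le (hP i) (D.q i) x y
    unfold g
    linarith
  unfold R L
  linarith

/-- The Lagrangian is affine in the multipliers. -/
theorem L_sub_L (x : Fin n1 → ℝ) (u : Fin n2 → ℝ) (lam lam' : Fin m1 → ℝ)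
    (gam gam' : Fin m2 → ℝ) :
    D.L x u lam' gam' - D.L x u lam gam = ∑ i, (lam' i - lam i) * D.g i x u
      + dot (gam' - gam) (D.A.mulVec x + D.B.mulVec u - D.b) := by
  simp only [L, dot, sub_mul, Pi.sub_apply, Finset.sum_sub_distrib]
  ring

end QCQP

open QCQP in
/-- **Lemma 3.**  At a saddle point `(x*,u*,λ*,γ*)` of the QCQP, for all
`x ∈ X`, `u ∈ ℝ^{n2}`, `λ ∈ ℝ_{≥0}^{m1}`, `γ ∈ ℝ^{m2}`:
`R(x*,u*; x,λ,γ) − R(x,u; x,λ,γ) ≤ Σ_i (λ*_i − λ_i) g_i(x,u) + (γ* − γ)ᵀ(Ax + Bu − b)`. -/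
theorem linearized_saddle_inequality {n1 n2 m1 m2 : ℕ}
    (hn1 : 0 < n1) (hn2 : 0 < n2) (hm1 : 0 < m1) (hm2 : 0 < m2)
    (D : QCQP n1 n2 m1 m2)
    (hP0 : D.P0.PosSemidef) (hP : ∀ i, (D.P i).PosSemidef) (hXbar : ∀ j, 0 < D.Xbar j)
    (xs : Fin n1 → ℝ) (us : Fin n2 → ℝ) (ls : Fin m1 → ℝ) (gs : Fin m2 → ℝ)
    (hsaddle : D.SaddlePoint xs us ls gs) :
    ∀ x ∈ D.Xset, ∀ u : Fin n2 → ℝ, ∀ lam : Fin m1 → ℝ, (∀ i, 0 ≤ lam i) →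
      ∀ gam : Fin m2 → ℝ,
      D.R xs us x lam gam - D.R x u x lam gam
        ≤ ∑ i, (ls i - lam i) * D.g i x u
          + dot (gs - gam) (D.A.mulVec x + D.B.mulVec u - D.b) := by
  intro x hx u lam hlam gam
  obtain ⟨-, -, hmax, hmin⟩ := hsaddle
  rw [← D.L_sub_L]
  linarith [D.R_sub_R_le_L_sub_L hP0 hP x xs u us hlam gam, hmax lam hlam gam, hmin x hx u]
end
end

section
/- Assume a saddle point (x*,u*,λ*,γ*) exists. Let (x^k,u^k,λ^k,γ^k) ∈ X × ℝ^{n2} × ℝ_{≥0}^{m1} × ℝ^{m2}, let ρ^{k+1} > 0, and let (μ^{k+1}, ν^{k+1}, y^{k+1}, v^{k+1}, x^{k+1}, u^{k+1}, λ^{k+1}, γ^{k+1}) be produced by one PC²PM iteration from (x^k,u^k,λ^k,γ^k) with step size ρ = ρ^{k+1}. Then ‖x^{k+1} − x*‖₂² + ‖u^{k+1} − u*‖₂² ≤ ‖x^k − x*‖₂² + ‖u^k − u*‖₂² − (‖y^{k+1} − x^{k+1}‖₂² + ‖v^{k+1} − u^{k+1}‖₂² + ‖y^{k+1} − x^k‖₂²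 + ‖v^{k+1} − u^k‖₂²) + 2ρ^{k+1} { (y^{k+1} − x^{k+1})ᵀ P_0 (y^{k+1} − x^k) + Σ_{i=1}^{m1} μ_i^{k+1} (y^{k+1} − x^{k+1})ᵀ P_i (y^{k+1} − x^k) + Σ_{i=1}^{m1} (λ_i* − μ_i^{k+1}) g_i(y^{k+1}, v^{k+1}) + (γ* − ν^{k+1})ᵀ (A y^{k+1} + B v^{k+1} − b) + Σ_{i=1}^{m1} (μ_i^{k+1} − λ_i^k) [ (P_i x^k + q_i)ᵀ (y^{k+1} − x^{k+1}) + c_iᵀ (v^{k+1} − u^{k+1}) ] + (ν^{k+1} − γ^k)ᵀ [ A (y^{k+1} − x^{k+1}) + B (v^{k+1} − u^{k+1}) ] }. -/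
noncomputable section

theorem dot_eq_dotProduct {n : ℕ} (x y : Fin n → ℝ) : dot x y = x ⬝ᵥ y := rfl

theorem sqnorm_eq_dot {n : ℕ} (x : Fin n → ℝ) : sqnorm x = dot x x := by
  simp only [sqnorm, dot, sq]

theorem dot_comm {n : ℕ} (x y : Fin n → ℝ) : dot x y = dot y x :=
  dotProduct_comm x y

theorem dot_add_left {n : ℕ} (x y z : Fin n → ℝ) : dot (x + y) z = dot x z + dot y z :=
  add_dotProduct x y z

theorem dot_add_right {n : ℕ} (x y z : Fin n → ℝ) : dot x (y + z) = dot x y + dot x z :=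
  dotProduct_add x y z

theorem dot_sub_left {n : ℕ} (x y z : Fin n → ℝ) : dot (x - y) z = dot x z - dot y z :=
  sub_dotProduct x y z

theorem dot_sub_right {n : ℕ} (x y z : Fin n → ℝ) : dot x (y - z) = dot x y - dot x z :=
  dotProduct_sub x y z

theorem dot_smul_left {n : ℕ} (a : ℝ) (x y : Fin n → ℝ) : dot (a • x) y = a * dot x y :=
  smul_dotProduct a x y

theorem dot_sum_left {n : ℕ} {ι : Type*} (s : Finset ι) (f : ι → Fin n → ℝ) (y : Fin n → ℝ) :
    dot (∑ i ∈ s, f i) y = ∑ i ∈ s, dot (f i) y :=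
  sum_dotProduct s f y

theorem dot_transpose_mulVec_left {m n : ℕ} (M : Matrix (Fin m) (Fin n) ℝ)
    (w : Fin m → ℝ) (d : Fin n → ℝ) : dot (M.transpose.mulVec w) d = dot w (M.mulVec d) := by
  rw [dot_eq_dotProduct, dot_eq_dotProduct, Matrix.mulVec_transpose, Matrix.dotProduct_mulVec]

/-- First-order lower bound for the convex quadratic form of a positive semidefinite matrix. -/
theorem Matrix.PosSemidef.dot_mulVec_sub_le {n : ℕ} {M : Matrix (Fin n) (Fin n) ℝ}
    (hM : M.PosSemidef) (x z : Fin n → ℝ) :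
    dot (M.mulVec x) (z - x) ≤ 1 / 2 * dot z (M.mulVec z) - 1 / 2 * dot x (M.mulVec x) := by
  have hnonneg : 0 ≤ dot (z - x) (M.mulVec (z - x)) := by
    simpa [dot_eq_dotProduct] using hM.dotProduct_mulVec_nonneg (z - x)
  have hsymm : M.transpose = M := by
    simpa [Matrix.IsHermitian] using hM.isHermitian
  have hadj : dot (M.mulVec x) z = dot x (M.mulVec z) := by
    simpa only [hsymm] using dot_transpose_mulVec_left M x z
  simp only [Matrix.mulVec_sub, dot_sub_left, dot_sub_right] at hnonneg ⊢
  linarith [dot_comm z (M.mulVec x), dot_comm x (M.mulVec x)]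

/-- Three-point inequality for a point `p` satisfying the variational inequality of a
projected step from `x` in direction `-G`. -/
theorem sqnorm_sub_le_of_step {n : ℕ} {ρ : ℝ} {x G p z : Fin n → ℝ}
    (h : dot (x - ρ • G - p) (z - p) ≤ 0) :
    sqnorm (p - z) ≤ sqnorm (x - z) - sqnorm (p - x) + 2 * ρ * dot G (z - p) := by
  simp only [sqnorm_eq_dot, dot_sub_left, dot_sub_right, dot_smul_left] at h ⊢
  linarith [dot_comm x z, dot_comm x p, dot_comm p z]

namespace QCQP

variable {n1 n2 m1 m2 : ℕ} (D : QCQP n1 n2 m1 m2)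

theorem proj_mem (hX : ∀ j, 0 ≤ D.Xbar j) (x : Fin n1 → ℝ) : D.proj x ∈ D.Xset :=
  fun j => ⟨le_min (le_max_right _ _) (hX j), min_le_right _ _⟩

theorem dot_sub_proj_nonpos (x : Fin n1 → ℝ) {z : Fin n1 → ℝ} (hz : z ∈ D.Xset) :
    dot (x - D.proj x) (z - D.proj x) ≤ 0 := by
  refine Finset.sum_nonpos fun j _ => ?_
  obtain ⟨h0, h1⟩ := hz j
  simp only [Pi.sub_apply, proj]
  rcases le_total (x j) 0 with hx | hx
  · rw [max_eq_right hx, min_eq_left (h0.trans h1)]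
    nlinarith
  · rw [max_eq_left hx]
    rcases le_total (x j) (D.Xbar j) with hb | hb
    · simp [min_eq_left hb]
    · rw [min_eq_right hb]
      nlinarith

theorem dot_gradx (x d : Fin n1 → ℝ) (lam : Fin m1 → ℝ) (gam : Fin m2 → ℝ) :
    dot (D.gradx x lam gam) d = dot (D.P0.mulVec x) d + dot D.q0 d
      + ∑ i, lam i * (dot ((D.P i).mulVec x) d + dot (D.q i) d) + dot gam (D.A.mulVec d) := by
  simp only [gradx, dot_add_left, dot_sum_left, dot_smul_left, dot_transpose_mulVec_left]

theorem dot_gradu (d : Fin n2 → ℝ) (lam : Fin m1 → ℝ) (gam : Fin m2 → ℝ) :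
    dot (D.gradu lam gam) d
      = dot D.c0 d + ∑ i, lam i * dot (D.c i) d + dot gam (D.B.mulVec d) := by
  simp only [gradu, dot_add_left, dot_sum_left, dot_smul_left, dot_transpose_mulVec_left]

/-- First-order lower bound for the Lagrangian, convex in the primal variables. -/
theorem dot_grad_le_L_sub (hP0 : D.P0.PosSemidef) (hP : ∀ i, (D.P i).PosSemidef)
    {lam : Fin m1 → ℝ} (hlam : ∀ i, 0 ≤ lam i) (gam : Fin m2 → ℝ)
    (x z : Fin n1 → ℝ) (u w : Fin n2 → ℝ) :
    dot (D.gradx x lam gam) (z - x) + dot (D.gradu lam gam) (w - u)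
      ≤ D.L z w lam gam - D.L x u lam gam := by
  have hg : ∑ i, lam i * (dot ((D.P i).mulVec x) (z - x) + dot (D.q i) (z - x))
      + ∑ i, lam i * dot (D.c i) (w - u)
      ≤ ∑ i, lam i * D.g i z w - ∑ i, lam i * D.g i x u := by
    rw [← Finset.sum_add_distrib, ← Finset.sum_sub_distrib]
    refine Finset.sum_le_sum fun i _ => ?_
    rw [← mul_add, ← mul_sub]
    refine mul_le_mul_of_nonneg_left ?_ (hlam i)
    have h := (hP i).dot_mulVec_sub_le x z
    rw [dot_sub_right (D.q i), dot_sub_right (D.c i), g, g]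
    linarith
  have h0 := hP0.dot_mulVec_sub_le x z
  rw [dot_gradx, dot_gradu, L, L]
  simp only [Matrix.mulVec_sub, dot_sub_right D.q0, dot_sub_right D.c0, dot_sub_right gam,
    dot_add_right gam]
  linarith

theorem L_sub_L_dual (x : Fin n1 → ℝ) (u : Fin n2 → ℝ)
    (lam lam' : Fin m1 → ℝ) (gam gam' : Fin m2 → ℝ) :
    D.L x u lam gam - D.L x u lam' gam'
      = ∑ i, (lam i - lam' i) * D.g i x u
        + dot (gam - gam') (D.A.mulVec x + D.B.mulVec u - D.b) := by
  simp only [L, sub_mul, Finset.sum_sub_distrib, dot_sub_left]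
  ring

theorem dot_grad_sub (x y d : Fin n1 → ℝ) (e : Fin n2 → ℝ)
    (lam mu : Fin m1 → ℝ) (gam nu : Fin m2 → ℝ) :
    dot (D.gradx y mu nu - D.gradx x lam gam) d + dot (D.gradu mu nu - D.gradu lam gam) e
      = dot d (D.P0.mulVec (y - x)) + (∑ i, mu i * dot d ((D.P i).mulVec (y - x)))
        + (∑ i, (mu i - lam i) * (dot ((D.P i).mulVec x + D.q i) d + dot (D.c i) e))
        + dot (nu - gam) (D.A.mulVec d + D.B.mulVec e) := by
  simp only [dot_sub_left, dot_gradx, dot_gradu, dot_comm d, Matrix.mulVec_sub, dot_add_left,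
    dot_add_right, sub_mul, mul_sub, mul_add, Finset.sum_sub_distrib, Finset.sum_add_distrib]
  ring

end QCQP

open QCQP in
/-- **Proposition 1, primal estimate (3.10).** -/
theorem primal_distance_estimate {n1 n2 m1 m2 : ℕ}
    (hn1 : 0 < n1) (hn2 : 0 < n2) (hm1 : 0 < m1) (hm2 : 0 < m2)
    (D : QCQP n1 n2 m1 m2)
    (hP0 : D.P0.PosSemidef) (hP : ∀ i, (D.P i).PosSemidef) (hXbar : ∀ j, 0 < D.Xbar j)
    (xs : Fin n1 → ℝ) (us : Fin n2 → ℝ) (ls : Fin m1 → ℝ) (gs : Fin m2 → ℝ)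
    (hsaddle : D.SaddlePoint xs us ls gs)
    (xk : Fin n1 → ℝ) (hxk : xk ∈ D.Xset) (uk : Fin n2 → ℝ)
    (lamk : Fin m1 → ℝ) (hlamk : ∀ i, 0 ≤ lamk i) (gamk : Fin m2 → ℝ)
    (ρ : ℝ) (hρ : 0 < ρ)
    (mu : Fin m1 → ℝ) (nu : Fin m2 → ℝ) (y : Fin n1 → ℝ) (v : Fin n2 → ℝ)
    (x1 : Fin n1 → ℝ) (u1 : Fin n2 → ℝ) (lam1 : Fin m1 → ℝ) (gam1 : Fin m2 → ℝ)
    (hiter : D.Iter ρ xk uk lamk gamk mu nu y v x1 u1 lam1 gam1) :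
    sqnorm (x1 - xs) + sqnorm (u1 - us)
      ≤ sqnorm (xk - xs) + sqnorm (uk - us)
        - (sqnorm (y - x1) + sqnorm (v - u1) + sqnorm (y - xk) + sqnorm (v - uk))
        + 2 * ρ * (dot (y - x1) (D.P0.mulVec (y - xk))
          + (∑ i, mu i * dot (y - x1) ((D.P i).mulVec (y - xk)))
          + (∑ i, (ls i - mu i) * D.g i y v)
          + dot (gs - nu) (D.A.mulVec y + D.B.mulVec v - D.b)
          + (∑ i, (mu i - lamk i)
              * (dot ((D.P i).mulVec xk + D.q i) (y - x1) + dot (D.c i) (v - u1)))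
          + dot (nu - gamk) (D.A.mulVec (y - x1) + D.B.mulVec (v - u1))) := by
  obtain ⟨hxs, _, hdual, hprimal⟩ := hsaddle
  have hX : ∀ j, 0 ≤ D.Xbar j := fun j => (hXbar j).le
  have hmu : ∀ i, 0 ≤ mu i := fun i => by
    rw [hiter.hmu i]
    exact le_max_left _ _
  have hyX : y ∈ D.Xset := hiter.hy ▸ D.proj_mem hX _
  have hx1X : x1 ∈ D.Xset := hiter.hx1 ▸ D.proj_mem hX _
  have hxcorr := sqnorm_sub_le_of_step (ρ := ρ) (x := xk) (G := D.gradx y mu nu) (p := x1)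
    (z := xs) (by rw [hiter.hx1]; exact D.dot_sub_proj_nonpos _ hxs)
  have hxpred := sqnorm_sub_le_of_step (ρ := ρ) (x := xk) (G := D.gradx xk lamk gamk) (p := y)
    (z := x1) (by rw [hiter.hy]; exact D.dot_sub_proj_nonpos _ hx1X)
  have hucorr := sqnorm_sub_le_of_step (ρ := ρ) (x := uk) (G := D.gradu mu nu) (p := u1)
    (z := us) (by simp [hiter.hu1, dot_eq_dotProduct])
  have hupred := sqnorm_sub_le_of_step (ρ := ρ) (x := uk) (G := D.gradu lamk gamk) (p := v)
    (z := u1) (by simp [hiter.hv, dot_eq_dotProduct])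
  have hsqx : sqnorm (xk - x1) = sqnorm (x1 - xk) := by
    simp only [sqnorm, Pi.sub_apply, sub_sq_comm]
  have hsqu : sqnorm (uk - u1) = sqnorm (u1 - uk) := by
    simp only [sqnorm, Pi.sub_apply, sub_sq_comm]
  have hconv := D.dot_grad_le_L_sub hP0 hP hmu nu y xs v us
  have hgap := D.L_sub_L_dual y v ls mu gs nu
  have hd := hdual mu hmu nu
  have hp := hprimal y hyX v
  have hdiff := D.dot_grad_sub xk y (y - x1) (v - u1) lamk mu gamk nu
  have hsplit : dot (D.gradx y mu nu) (xs - x1) + dot (D.gradx xk lamk gamk) (x1 - y)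
      + dot (D.gradu mu nu) (us - u1) + dot (D.gradu lamk gamk) (u1 - v)
      = dot (D.gradx y mu nu) (xs - y) + dot (D.gradu mu nu) (us - v)
        + (dot (D.gradx y mu nu - D.gradx xk lamk gamk) (y - x1)
          + dot (D.gradu mu nu - D.gradu lamk gamk) (v - u1)) := by
    simp only [dot_sub_left, dot_sub_right]
    ring
  have hinner := add_le_add (hconv.trans (sub_le_sub_right (hd.trans hp) _)) hdiff.le
  rw [← hsplit, hgap] at hinner
  have hscaled := mul_le_mul_of_nonneg_left hinner (mul_nonneg zero_le_two hρ.le)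
  linarith
end
end

section
/- Assume a saddle point (x*,u*,λ*,γ*) exists. Let (x^k,u^k,λ^k,γ^k) ∈ X × ℝ^{n2} × ℝ_{≥0}^{m1} × ℝ^{m2}, let ρ^{k+1} > 0, and let (μ^{k+1}, ν^{k+1}, y^{k+1}, v^{k+1}, x^{k+1}, u^{k+1}, λ^{k+1}, γ^{k+1}) be produced by one PC²PM iteration from (x^k,u^k,λ^k,γ^k) with step size ρ = ρ^{k+1}. Then ‖λ^{k+1} − λ*‖₂² + ‖γ^{k+1} − γ*‖₂² ≤ ‖λ^k − λ*‖₂² + ‖γ^k − γ*‖₂² − (‖μ^{k+1} − λ^{k+1}‖₂² + ‖ν^{k+1} − γ^{k+1}‖₂² + ‖μ^{k+1} − λ^k‖₂² + ‖ν^{k+1} − γ^k‖₂²) + 2ρ^{k+1} { Σ_{i=1}^{m1} (λ_i^{k+1} − λ_i*) g_i(y^{k+1}, v^{k+1}) + (γ^{k+1} − γ*)ᵀ (A y^{k+1} + B v^{k+1} − b) + Σ_{i=1}^{m1} (μ_i^{k+1} − λ_i^{k+1}) g_i(x^k, u^k) + (ν^{k+1} − γ^{k+1})ᵀ (A x^k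 + B u^k − b) }. -/
noncomputable section

/-- Variational characterization of the projection of `t` onto the nonnegative half-line. -/
lemma max_zero_sub_mul_nonneg {t z : ℝ} (hz : 0 ≤ z) :
    0 ≤ (max 0 t - t) * (z - max 0 t) := by
  rcases le_total t 0 with h | h
  · rw [max_eq_left h]
    nlinarith
  · simp [max_eq_right h]

/-- Predictor-corrector distance estimate in one dimension, from the variational inequalities
satisfied by the predictor `p` and the corrector `l`. -/
lemma sq_sub_le_of_predictor_corrector {ρ k p l s a c : ℝ}
    (hp : 0 ≤ (p - (k + ρ * a)) * (l - p)) (hl : 0 ≤ (l - (k + ρ * c)) * (s - l)) :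
    (l - s) ^ 2 ≤ (k - s) ^ 2 - ((p - l) ^ 2 + (p - k) ^ 2)
      + 2 * ρ * ((l - s) * c + (p - l) * a) := by
  linarith

/-- Summed form of `sq_sub_le_of_predictor_corrector`. -/
lemma sqnorm_sub_le_of_predictor_corrector {n : ℕ} {ρ : ℝ} {k p l s a c : Fin n → ℝ}
    (hp : ∀ i, 0 ≤ (p i - (k i + ρ * a i)) * (l i - p i))
    (hl : ∀ i, 0 ≤ (l i - (k i + ρ * c i)) * (s i - l i)) :
    sqnorm (l - s) ≤ sqnorm (k - s) - (sqnorm (p - l) + sqnorm (p - k))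
      + 2 * ρ * (dot (l - s) c + dot (p - l) a) := by
  simp only [sqnorm, dot, Pi.sub_apply, ← Finset.sum_add_distrib, ← Finset.sum_sub_distrib,
    Finset.mul_sum]
  exact Finset.sum_le_sum fun i _ => sq_sub_le_of_predictor_corrector (hp i) (hl i)

open QCQP in
/-- **Proposition 1, dual estimate (3.11).** -/
theorem dual_distance_estimate {n1 n2 m1 m2 : ℕ}
    (hn1 : 0 < n1) (hn2 : 0 < n2) (hm1 : 0 < m1) (hm2 : 0 < m2)
    (D : QCQP n1 n2 m1 m2)
    (hP0 : D.P0.PosSemidef) (hP : ∀ i, (D.P i).PosSemidef) (hXbar : ∀ j, 0 < D.Xbar j)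
    (xs : Fin n1 → ℝ) (us : Fin n2 → ℝ) (ls : Fin m1 → ℝ) (gs : Fin m2 → ℝ)
    (hsaddle : D.SaddlePoint xs us ls gs)
    (xk : Fin n1 → ℝ) (hxk : xk ∈ D.Xset) (uk : Fin n2 → ℝ)
    (lamk : Fin m1 → ℝ) (hlamk : ∀ i, 0 ≤ lamk i) (gamk : Fin m2 → ℝ)
    (ρ : ℝ) (hρ : 0 < ρ)
    (mu : Fin m1 → ℝ) (nu : Fin m2 → ℝ) (y : Fin n1 → ℝ) (v : Fin n2 → ℝ)
    (x1 : Fin n1 → ℝ) (u1 : Fin n2 → ℝ) (lam1 : Fin m1 → ℝ) (gam1 : Fin m2 → ℝ)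
    (hiter : D.Iter ρ xk uk lamk gamk mu nu y v x1 u1 lam1 gam1) :
    sqnorm (lam1 - ls) + sqnorm (gam1 - gs)
      ≤ sqnorm (lamk - ls) + sqnorm (gamk - gs)
        - (sqnorm (mu - lam1) + sqnorm (nu - gam1) + sqnorm (mu - lamk) + sqnorm (nu - gamk))
        + 2 * ρ * ((∑ i, (lam1 i - ls i) * D.g i y v)
          + dot (gam1 - gs) (D.A.mulVec y + D.B.mulVec v - D.b)
          + (∑ i, (mu i - lam1 i) * D.g i xk uk)
          + dot (nu - gam1) (D.A.mulVec xk + D.B.mulVec uk - D.b)) := by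
  have hlam := sqnorm_sub_le_of_predictor_corrector (ρ := ρ) (k := lamk) (p := mu) (l := lam1)
    (s := ls) (a := fun i => D.g i xk uk) (c := fun i => D.g i y v)
    (fun i => by
      rw [hiter.hmu i]
      exact max_zero_sub_mul_nonneg (hiter.hlam1 i ▸ le_max_left _ _))
    (fun i => by
      rw [hiter.hlam1 i]
      exact max_zero_sub_mul_nonneg (hsaddle.2.1 i))
  have hgam := sqnorm_sub_le_of_predictor_corrector (ρ := ρ) (k := gamk) (p := nu) (l := gam1)
    (s := gs) (a := D.A.mulVec xk + D.B.mulVec uk - D.b) (c := D.A.mulVec y + D.B.mulVec v - D.b)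
    (fun i => by simp [hiter.hnu]) (fun i => by simp [hiter.hgam1])
  simp only [dot, Pi.sub_apply] at hlam hgam ⊢
  linarith
end
end
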